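/- If x ∈ Λ_{p̂} satisfies ‖x‖_{p̂} = 1 and σ(x) = 1, then x is an extreme point of the closed unit ball B(Λ_{p̂}) = {y ∈ Λ_{p̂} : ‖y‖_{p̂} ≤ 1}; that is, there do not exist y, z ∈ B(Λ_{p̂}) with y ≠ z and 2x = y + z. (Since each p_n > 1, the functions t ↦ |t|^{p_n} are strictly convex, so the paper's set A_x is empty and its cardinality condition Card(A_x) ≤ 1 holds automatically.) -/

import Mathlib

open Filter Topology

/-- Weight `λ_k − λ_{k−1}` with the convention `λ_{−1} = 0`. -/
noncomputable def dLam (l : ℕ → ℝ) (k : ℕ) : ℝ :=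
  l k - (if k = 0 then 0 else l (k - 1))

/-- `Λx(n) = (1/λ_n) ∑_{k=0}^n (λ_k − λ_{k−1})|x_k|`. -/
noncomputable def LamAvg (l : ℕ → ℝ) (x : ℕ → ℝ) (n : ℕ) : ℝ :=
  (1 / l n) * ∑ k ∈ Finset.range (n + 1), dLam l k * |x k|

/-- The modular `σ(x) = ∑_{n=0}^∞ (Λx(n))^{p_n}`. -/
noncomputable def sigmaMod (l pp : ℕ → ℝ) (x : ℕ → ℝ) : ℝ :=
  ∑' n : ℕ, (LamAvg l x n) ^ (pp n)

/-- The modular of `x` is finite (the defining series converges). -/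
def FiniteMod (l pp : ℕ → ℝ) (x : ℕ → ℝ) : Prop :=
  Summable fun n : ℕ => (LamAvg l x n) ^ (pp n)

/-- Membership in `Λ_{p̂}` : `σ(rx) < ∞` for some `r > 0`. -/
def MemLam (l pp : ℕ → ℝ) (x : ℕ → ℝ) : Prop :=
  ∃ r : ℝ, 0 < r ∧ FiniteMod l pp (fun k => r * x k)

/-- The Luxemburg norm `‖x‖_{p̂} = inf { r > 0 : σ(x/r) ≤ 1 }`. -/
noncomputable def luxNorm (l pp : ℕ → ℝ) (x : ℕ → ℝ) : ℝ :=
  sInf {r : ℝ | 0 < r ∧ FiniteMod l pp (fun k => x k / r) ∧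
    sigmaMod l pp (fun k => x k / r) ≤ 1}

lemma dLam_pos {l : ℕ → ℝ} (hpos : ∀ k, 0 < l k) (hmono : StrictMono l) (k : ℕ) :
    0 < dLam l k := by
  unfold dLam
  split_ifs with h
  · simpa using hpos k
  · exact sub_pos.2 (hmono (by omega))

lemma LamAvg_nonneg {l : ℕ → ℝ} (hpos : ∀ k, 0 < l k) (hmono : StrictMono l)
    (x : ℕ → ℝ) (n : ℕ) : 0 ≤ LamAvg l x n :=
  mul_nonneg (one_div_pos.2 (hpos n)).le
    (Finset.sum_nonneg fun k _ => mul_nonneg (dLam_pos hpos hmono k).le (abs_nonneg _))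

lemma LamAvg_const_mul (l x : ℕ → ℝ) {c : ℝ} (hc : 0 ≤ c) (n : ℕ) :
    LamAvg l (fun k => c * x k) n = c * LamAvg l x n := by
  simp only [LamAvg, abs_mul, abs_of_nonneg hc, Finset.mul_sum]
  exact Finset.sum_congr rfl fun k _ => by ring

lemma LamAvg_div (l x : ℕ → ℝ) {r : ℝ} (hr : 0 < r) (n : ℕ) :
    LamAvg l (fun k => x k / r) n = LamAvg l x n / r := by
  simpa only [div_eq_inv_mul] using LamAvg_const_mul l x (inv_nonneg.2 hr.le) n

lemma LamAvg_le_midpoint {l : ℕ → ℝ} (hpos : ∀ k, 0 < l k) (hmono : StrictMono l)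
    {x y z : ℕ → ℝ} (h : ∀ k, 2 * x k = y k + z k) (n : ℕ) :
    LamAvg l x n ≤ (LamAvg l y n + LamAvg l z n) / 2 := by
  have hsum : ∑ k ∈ Finset.range (n + 1), dLam l k * |x k| ≤
      ∑ k ∈ Finset.range (n + 1), (dLam l k * |y k| + dLam l k * |z k|) / 2 := by
    refine Finset.sum_le_sum fun k _ => ?_
    have hx : |x k| ≤ (|y k| + |z k|) / 2 := by
      have h2 : |2 * x k| ≤ |y k| + |z k| := h k ▸ abs_add_le _ _
      rw [abs_mul, abs_two] at h2
      linarith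
    have := mul_le_mul_of_nonneg_left hx (dLam_pos hpos hmono k).le
    linarith
  rw [← Finset.sum_div, Finset.sum_add_distrib] at hsum
  have := mul_le_mul_of_nonneg_left hsum (one_div_pos.2 (hpos n)).le
  unfold LamAvg
  linarith

/-- The averages determine the absolute values of the sequence. -/
lemma abs_eq_of_LamAvg_eq {l : ℕ → ℝ} (hpos : ∀ k, 0 < l k) (hmono : StrictMono l)
    {x y : ℕ → ℝ} (h : ∀ n, LamAvg l x n = LamAvg l y n) (k : ℕ) : |x k| = |y k| := by
  have hS : ∀ n, ∑ k ∈ Finset.range n, dLam l k * |x k| =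
      ∑ k ∈ Finset.range n, dLam l k * |y k| := by
    rintro (_ | n)
    · simp
    · exact mul_left_cancel₀ (one_div_pos.2 (hpos n)).ne' (h n)
  have hk := hS (k + 1)
  rw [Finset.sum_range_succ, Finset.sum_range_succ, hS k] at hk
  exact mul_left_cancel₀ (dLam_pos hpos hmono k).ne' (add_left_cancel hk)

/-- Some positive rescaling of an element of the space has modular at most `1`. -/
lemma luxNorm_set_nonempty {l pp : ℕ → ℝ} (hpos : ∀ k, 0 < l k) (hmono : StrictMono l)
    (hpp : ∀ n, 1 ≤ pp n) {y : ℕ → ℝ} (hy : MemLam l pp y) :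
    {r : ℝ | 0 < r ∧ FiniteMod l pp (fun k => y k / r) ∧
      sigmaMod l pp (fun k => y k / r) ≤ 1}.Nonempty := by
  obtain ⟨r, hr, hfin⟩ := hy
  set S := sigmaMod l pp (fun k => r * y k) with hS
  have hA := LamAvg_nonneg hpos hmono (fun k => r * y k)
  have hS0 : 0 ≤ S := tsum_nonneg fun n => Real.rpow_nonneg (hA n) _
  have hpos' : 0 < 1 + S := by linarith
  have hle : ∀ n, LamAvg l (fun k => y k / ((1 + S) / r)) n ^ pp n ≤
      (1 + S)⁻¹ * LamAvg l (fun k => r * y k) n ^ pp n := by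
    intro n
    have heq : (fun k => y k / ((1 + S) / r)) = fun k => (1 + S)⁻¹ * (r * y k) := by
      funext k
      field_simp
    rw [heq, LamAvg_const_mul _ _ (inv_nonneg.2 hpos'.le),
      Real.mul_rpow (inv_nonneg.2 hpos'.le) (hA n)]
    refine mul_le_mul_of_nonneg_right ?_ (Real.rpow_nonneg (hA n) _)
    exact Real.rpow_le_self_of_le_one (inv_nonneg.2 hpos'.le)
      (inv_le_one_of_one_le₀ (by linarith)) (hpp n)
  have hsum : FiniteMod l pp (fun k => y k / ((1 + S) / r)) :=
    Summable.of_nonneg_of_le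
      (fun n => Real.rpow_nonneg (LamAvg_nonneg hpos hmono _ n) _) hle (hfin.mul_left _)
  refine ⟨(1 + S) / r, div_pos hpos' hr, hsum, ?_⟩
  calc sigmaMod l pp (fun k => y k / ((1 + S) / r))
      ≤ ∑' n, (1 + S)⁻¹ * LamAvg l (fun k => r * y k) n ^ pp n :=
        hsum.tsum_le_tsum hle (hfin.mul_left _)
    _ = (1 + S)⁻¹ * S := by rw [tsum_mul_left, hS, sigmaMod]
    _ ≤ 1 := by
        rw [inv_mul_le_iff₀ hpos']
        linarith

/-- The modular is at most `1` on the closed unit ball of the Luxemburg norm. -/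
lemma finiteMod_and_sigmaMod_le_one {l pp : ℕ → ℝ} (hpos : ∀ k, 0 < l k)
    (hmono : StrictMono l) (hpp : ∀ n, 1 ≤ pp n) {y : ℕ → ℝ} (hy : MemLam l pp y)
    (hnorm : luxNorm l pp y ≤ 1) : FiniteMod l pp y ∧ sigmaMod l pp y ≤ 1 := by
  have hA := LamAvg_nonneg hpos hmono y
  have hnn : ∀ n, 0 ≤ LamAvg l y n ^ pp n := fun n => Real.rpow_nonneg (hA n) _
  have hscaled : ∀ N, ∀ r : ℝ, 1 < r →
      ∑ n ∈ Finset.range N, (LamAvg l y n / r) ^ pp n ≤ 1 := by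
    intro N r hr
    obtain ⟨s, ⟨hs, hfin, hle⟩, hsr⟩ :=
      exists_lt_of_csInf_lt (luxNorm_set_nonempty hpos hmono hpp hy) (hnorm.trans_lt hr)
    calc ∑ n ∈ Finset.range N, (LamAvg l y n / r) ^ pp n
        ≤ ∑ n ∈ Finset.range N, LamAvg l (fun k => y k / s) n ^ pp n := by
          refine Finset.sum_le_sum fun n _ => ?_
          rw [LamAvg_div _ _ hs]
          exact Real.rpow_le_rpow (div_nonneg (hA n) (by linarith))
            (div_le_div_of_nonneg_left (hA n) hs hsr.le) (by linarith [hpp n])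
      _ ≤ sigmaMod l pp (fun k => y k / s) :=
          hfin.sum_le_tsum _ fun n _ =>
            Real.rpow_nonneg (LamAvg_nonneg hpos hmono _ n) _
      _ ≤ 1 := hle
  have hpartial : ∀ N, ∑ n ∈ Finset.range N, LamAvg l y n ^ pp n ≤ 1 := by
    intro N
    have hlim : Tendsto (fun r : ℝ => ∑ n ∈ Finset.range N, (LamAvg l y n / r) ^ pp n)
        (𝓝[>] 1) (𝓝 (∑ n ∈ Finset.range N, (LamAvg l y n / 1) ^ pp n)) := by
      refine tendsto_finsetSum _ fun n _ => ?_
      refine Tendsto.rpow_const ?_ (Or.inr (by linarith [hpp n]))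
      exact (tendsto_const_nhds.div tendsto_id one_ne_zero).mono_left nhdsWithin_le_nhds
    simp only [div_one] at hlim
    exact le_of_tendsto hlim (eventually_nhdsWithin_of_forall fun r hr => hscaled N r hr)
  exact ⟨summable_of_sum_range_le hnn hpartial, Real.tsum_le_of_sum_range_le hnn hpartial⟩

/-- Equality case of the midpoint convexity inequality for `t ↦ t ^ p`, `p > 1`. -/
lemma eq_and_eq_of_rpow_midpoint_le {p a b c : ℝ} (hp : 1 < p) (ha : 0 ≤ a) (hb : 0 ≤ b)
    (hc : 0 ≤ c) (hca : c ≤ (a + b) / 2) (h : (a ^ p + b ^ p) / 2 ≤ c ^ p) :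
    a = b ∧ c = a := by
  have hab : a = b := by
    by_contra hne
    have hlt := (strictConvexOn_rpow hp).2 ha hb hne
      one_half_pos one_half_pos (add_halves 1)
    simp only [smul_eq_mul] at hlt
    have hle := Real.rpow_le_rpow hc hca (by linarith : 0 ≤ p)
    rw [show (a + b) / 2 = 1 / 2 * a + 1 / 2 * b by ring] at hle
    linarith
  subst hab
  refine ⟨rfl, le_antisymm (by linarith) ?_⟩
  rw [← Real.rpow_le_rpow_iff ha hc (by linarith : 0 < p)]
  linarith

/-- If `x ∈ S(Λ_{p̂})` with `σ(x) = 1`, then `x` is an extreme point of the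
closed unit ball of `Λ_{p̂}`. -/
theorem modular_eq_one_extreme_point (l pp : ℕ → ℝ)
    (hpos : ∀ k, 0 < l k) (hmono : StrictMono l)
    (htop : Tendsto l atTop atTop)
    (hratio : Tendsto (fun k => l (k + 1) / l k) atTop (𝓝 1))
    (hpp : ∀ n, 1 < pp n) (hbdd : ∃ M : ℝ, ∀ n, pp n ≤ M)
    (x : ℕ → ℝ) (hx : MemLam l pp x) (hnorm : luxNorm l pp x = 1)
    (hmod : sigmaMod l pp x = 1) :
    ¬ ∃ y z : ℕ → ℝ, MemLam l pp y ∧ MemLam l pp z ∧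
      luxNorm l pp y ≤ 1 ∧ luxNorm l pp z ≤ 1 ∧ y ≠ z ∧
      (∀ k, 2 * x k = y k + z k) := by
  rintro ⟨y, z, hy, hz, hny, hnz, hne, hxyz⟩
  have hpp' : ∀ n, 1 ≤ pp n := fun n => (hpp n).le
  obtain ⟨hyf, hy1⟩ := finiteMod_and_sigmaMod_le_one hpos hmono hpp' hy hny
  obtain ⟨hzf, hz1⟩ := finiteMod_and_sigmaMod_le_one hpos hmono hpp' hz hnz
  have hxf : FiniteMod l pp x := by
    by_contra hns
    exact zero_ne_one ((tsum_eq_zero_of_not_summable hns).symm.trans hmod)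
  have hX := LamAvg_nonneg hpos hmono x
  have hY := LamAvg_nonneg hpos hmono y
  have hZ := LamAvg_nonneg hpos hmono z
  have hmid := LamAvg_le_midpoint hpos hmono hxyz
  have hconv : ∀ n, LamAvg l x n ^ pp n ≤
      (LamAvg l y n ^ pp n + LamAvg l z n ^ pp n) / 2 := by
    intro n
    have hle := Real.rpow_le_rpow (hX n) (hmid n) (by linarith [hpp n] : 0 ≤ pp n)
    have hcv := (convexOn_rpow (hpp' n)).2 (hY n) (hZ n)
      one_half_pos.le one_half_pos.le (add_halves 1)
    simp only [smul_eq_mul] at hcv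
    rw [show (LamAvg l y n + LamAvg l z n) / 2 =
      1 / 2 * LamAvg l y n + 1 / 2 * LamAvg l z n by ring] at hle
    linarith
  have hgap : HasSum (fun n => (LamAvg l y n ^ pp n + LamAvg l z n ^ pp n) / 2 -
      LamAvg l x n ^ pp n) ((sigmaMod l pp y + sigmaMod l pp z) / 2 - sigmaMod l pp x) :=
    ((hyf.hasSum.add hzf.hasSum).div_const 2).sub hxf.hasSum
  have heq : ∀ n, LamAvg l y n = LamAvg l z n ∧ LamAvg l x n = LamAvg l y n := by
    intro n
    have hn := le_hasSum hgap n fun m _ => sub_nonneg.2 (hconv m)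
    exact eq_and_eq_of_rpow_midpoint_le (hpp n) (hY n) (hZ n) (hX n) (hmid n) (by linarith)
  refine hne (funext fun k => ?_)
  have hyz := abs_eq_of_LamAvg_eq hpos hmono (fun n => (heq n).1) k
  have hxy := abs_eq_of_LamAvg_eq hpos hmono (fun n => (heq n).2) k
  rcases abs_eq_abs.1 hyz with h | h
  · exact h
  · have hx0 : x k = 0 := by linarith [hxyz k]
    have hy0 : y k = 0 := by simpa [hx0, eq_comm] using hxy
    linarith
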